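/- arXiv:0811.3366 — 2 statements merged into one kernel-verified Lean document; each statement's English description precedes it below -/
import Mathlib

section
/- Let K be a field, σ a type, and S = MvPolynomial σ K. Let r ≥ 2, let Γ_2, ..., Γ_r be pairwise disjoint nonempty subsets of σ, and let B_2 ⊆ B_3 ⊆ ... ⊆ B_r be subsets of S such that no variable from Γ_2 ∪ ... ∪ Γ_r occurs in any polynomial of B_r. For 1 ≤ i ≤ r let A_i ⊆ S denote the ideal generated by the variables indexed by Γ_{i+1} ∪ ... ∪ Γ_r (so A_r = 0). Then A_1 ∩ (A_2 + Ideal.span B_2) ∩ (A_3 + Ideal.span B_3) ∩ ... ∩ (A_r + Ideal.span B_r) equals the ideal generated by the set ⋃_{i=2}^{r} { X_γ · f : γ ∈ Γ_i, f ∈ B_i }, where X_γ denotes the variable of S indexed by γ. -/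
open MvPolynomial

namespace MvPolynomial

variable {K : Type*} [Field K] {σ : Type*}

open Classical in
/-- The algebra endomorphism sending the variables in `W` to zero and fixing all others. -/
noncomputable def killVars (K : Type*) [Field K] {σ : Type*} (W : Set σ) :
    MvPolynomial σ K →ₐ[K] MvPolynomial σ K :=
  aeval fun i => if i ∈ W then 0 else X i

lemma killVars_X_of_mem {W : Set σ} {i : σ} (hi : i ∈ W) : killVars K W (X i) = 0 := by
  simp [killVars, hi]

lemma killVars_X_of_notMem {W : Set σ} {i : σ} (hi : i ∉ W) : killVars K W (X i) = X i := by
  simp [killVars, hi]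

lemma killVars_eq_self {W : Set σ} {p : MvPolynomial σ K} (hp : ∀ i ∈ W, i ∉ p.vars) :
    killVars K W p = p := by
  refine hom_congr_vars (f₁ := (killVars K W).toRingHom) (f₂ := RingHom.id _) ?_ ?_ rfl
  · ext a
    simp [killVars]
  · intro i hi _
    exact killVars_X_of_notMem fun hW => hp i hW hi

lemma sub_killVars_mem (W : Set σ) (p : MvPolynomial σ K) :
    p - killVars K W p ∈ Ideal.span (X '' W) := by
  rw [← Ideal.Quotient.eq]
  suffices h : Ideal.Quotient.mkₐ K (Ideal.span (X '' W)) =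
      (Ideal.Quotient.mkₐ K (Ideal.span (X '' W))).comp (killVars K W) from
    DFunLike.congr_fun h p
  ext i
  by_cases hi : i ∈ W
  · simpa [killVars_X_of_mem hi] using
      Ideal.Quotient.eq_zero_iff_mem.mpr (Ideal.subset_span (Set.mem_image_of_mem X hi))
  · simp [killVars_X_of_notMem hi]

lemma killVars_eq_zero {W : Set σ} {p : MvPolynomial σ K} (hp : p ∈ Ideal.span (X '' W)) :
    killVars K W p = 0 := by
  have h : Ideal.span (X '' W) ≤ RingHom.ker (killVars K W) := by
    rw [Ideal.span_le]
    rintro _ ⟨i, hi, rfl⟩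
    exact killVars_X_of_mem hi
  exact h hp

lemma killVars_mem_span_X {W Γ : Set σ} {p : MvPolynomial σ K}
    (hp : p ∈ Ideal.span (X '' Γ)) : killVars K W p ∈ Ideal.span (X '' Γ) := by
  have h : Ideal.span (X '' Γ) ≤ (Ideal.span (X '' Γ)).comap (killVars K W) := by
    rw [Ideal.span_le]
    rintro _ ⟨i, hi, rfl⟩
    by_cases hW : i ∈ W
    · simp [killVars_X_of_mem hW]
    · simpa [killVars_X_of_notMem hW] using Ideal.subset_span (Set.mem_image_of_mem X hi)
  exact h hp

lemma killVars_mem_span {W : Set σ} {B : Set (MvPolynomial σ K)}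
    (hB : ∀ f ∈ B, ∀ i ∈ W, i ∉ f.vars) {p : MvPolynomial σ K}
    (hp : p ∈ Ideal.span B) : killVars K W p ∈ Ideal.span B := by
  have h : Ideal.span B ≤ (Ideal.span B).comap (killVars K W) := by
    rw [Ideal.span_le]
    intro f hf
    simpa [killVars_eq_self (hB f hf)] using Ideal.subset_span hf
  exact h hp

lemma sub_killVars_mem_mul {W : Set σ} {B : Set (MvPolynomial σ K)}
    (hB : ∀ f ∈ B, ∀ i ∈ W, i ∉ f.vars) {p : MvPolynomial σ K} (hp : p ∈ Ideal.span B) :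
    p - killVars K W p ∈ Ideal.span (X '' W) * Ideal.span B := by
  induction hp using Submodule.span_induction with
  | mem f hf => simp [killVars_eq_self (hB f hf)]
  | zero => simp
  | add p q _ _ hp hq =>
    rw [map_add, add_sub_add_comm]
    exact add_mem hp hq
  | smul c p hp ih =>
    have h : c • p - killVars K W (c • p) =
        (c - killVars K W c) * p + killVars K W c * (p - killVars K W p) := by
      rw [smul_eq_mul, map_mul]
      ring
    rw [h]
    exact add_mem (Ideal.mul_mem_mul (sub_killVars_mem W c) hp) (Ideal.mul_mem_left _ _ ih)

/-- An ideal generated by variables meets an ideal generated by polynomials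
free of these variables in the product of the two ideals. -/
lemma span_X_inf_span_le_mul {Γ : Set σ} {B : Set (MvPolynomial σ K)}
    (hB : ∀ f ∈ B, ∀ i ∈ Γ, i ∉ f.vars) :
    Ideal.span (X '' Γ) ⊓ Ideal.span B ≤ Ideal.span (X '' Γ) * Ideal.span B := by
  rintro p ⟨hΓ, hp⟩
  simpa [killVars_eq_zero hΓ] using sub_killVars_mem_mul hB hp

lemma span_X_inf_sup_span_le {Γ W : Set σ} {B : Set (MvPolynomial σ K)}
    (hΓ : ∀ f ∈ B, ∀ i ∈ Γ, i ∉ f.vars) (hW : ∀ f ∈ B, ∀ i ∈ W, i ∉ f.vars) :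
    Ideal.span (X '' Γ) ⊓ (Ideal.span (X '' W) ⊔ Ideal.span B) ≤
      Ideal.span (X '' W) ⊔ Ideal.span (X '' Γ) * Ideal.span B := by
  rintro p ⟨hpΓ, hp⟩
  have hmem : killVars K W p ∈ Ideal.span B := by
    obtain ⟨a, ha, b, hb, rfl⟩ := Submodule.mem_sup.mp hp
    rw [map_add, killVars_eq_zero ha, zero_add]
    exact killVars_mem_span hW hb
  rw [← sub_add_cancel p (killVars K W p)]
  exact Submodule.add_mem_sup (sub_killVars_mem W p)
    (span_X_inf_span_le_mul hΓ ⟨killVars_mem_span_X hpΓ, hmem⟩)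

end MvPolynomial

/-- **the key Lemma.** Let `Γ 2, ..., Γ r` be pairwise disjoint nonempty sets of
variables, `B 2 ⊆ ... ⊆ B r` sets of polynomials in which no variable of `Γ 2 ∪ ... ∪ Γ r`
occurs, and let `A i` be the ideal generated by the variables indexed by `Γ (i+1) ∪ ... ∪ Γ r`.
Then `A 1 ∩ (A 2 + (B 2)) ∩ ... ∩ (A r + (B r)) = (⋃_{i=2}^r Γ i × B i)`. -/
theorem ferrer_lemma_intersection {K : Type*} [Field K] {σ : Type*}
    (r : ℕ) (hr : 2 ≤ r)
    (Γ : ℕ → Set σ) (B : ℕ → Set (MvPolynomial σ K))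
    (hΓne : ∀ i, 2 ≤ i → i ≤ r → (Γ i).Nonempty)
    (hΓdisj : ∀ i j, 2 ≤ i → i ≤ r → 2 ≤ j → j ≤ r → i ≠ j → Disjoint (Γ i) (Γ j))
    (hB : ∀ i j, 2 ≤ i → i ≤ j → j ≤ r → B i ⊆ B j)
    (hvars : ∀ f ∈ B r, ∀ i, 2 ≤ i → i ≤ r → ∀ γ ∈ Γ i, γ ∉ f.vars)
    (A : ℕ → Ideal (MvPolynomial σ K))
    (hA : ∀ i, A i = Ideal.span (X '' (⋃ j ∈ Set.Icc (i + 1) r, Γ j))) :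
    (A 1 ⊓ ⨅ i ∈ Finset.Icc 2 r, (A i ⊔ Ideal.span (B i))) =
      Ideal.span (⋃ i ∈ Set.Icc 2 r,
        {g : MvPolynomial σ K | ∃ γ ∈ Γ i, ∃ f ∈ B i, g = X γ * f}) := by
  have hBvars {i : ℕ} (h2 : 2 ≤ i) (hir : i ≤ r) {j : ℕ} (hj2 : 2 ≤ j) (hjr : j ≤ r) :
      ∀ f ∈ B i, ∀ γ ∈ Γ j, γ ∉ f.vars :=
    fun f hf => hvars f (hB i r h2 hir le_rfl hf) j hj2 hjr
  have hmemA {i j : ℕ} (hij : i < j) (hjr : j ≤ r) {γ : σ} (hγ : γ ∈ Γ j) : X γ ∈ A i := by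
    rw [hA]
    exact Ideal.subset_span
      (Set.mem_image_of_mem X (Set.mem_biUnion (Set.mem_Icc.mpr ⟨hij, hjr⟩) hγ))
  apply le_antisymm
  · set J : ℕ → Ideal (MvPolynomial σ K) := fun k => Ideal.span (⋃ i ∈ Set.Icc 2 k,
      {g : MvPolynomial σ K | ∃ γ ∈ Γ i, ∃ f ∈ B i, g = X γ * f}) with hJ
    have hJmono (k : ℕ) : J k ≤ J (k + 1) :=
      Ideal.span_mono (Set.biUnion_subset_biUnion_left (Set.Icc_subset_Icc_right k.le_succ))
    have hJB {k : ℕ} (hk : k + 1 ≤ r) : J k ≤ Ideal.span (B (k + 1)) := by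
      rw [hJ, Ideal.span_le]
      refine Set.iUnion₂_subset fun i hi => ?_
      rintro _ ⟨γ, -, f, hf, rfl⟩
      exact Ideal.mul_mem_left _ _
        (Ideal.subset_span (hB i (k + 1) hi.1 (hi.2.trans k.le_succ) hk hf))
    have hmulJ {k : ℕ} (hk : 2 ≤ k) : Ideal.span (X '' Γ k) * Ideal.span (B k) ≤ J k := by
      rw [Ideal.span_mul_span', Ideal.span_le]
      rintro _ ⟨_, ⟨γ, hγ, rfl⟩, f, hf, rfl⟩
      exact Ideal.subset_span
        (Set.mem_biUnion (Set.mem_Icc.mpr ⟨hk, le_rfl⟩) ⟨γ, hγ, f, hf, rfl⟩)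
    have hAsucc {k : ℕ} : A k ≤ Ideal.span (X '' Γ (k + 1)) ⊔ A (k + 1) := by
      rw [hA k, Ideal.span_le]
      rintro _ ⟨γ, hγ, rfl⟩
      obtain ⟨j, hj, hγj⟩ := Set.mem_iUnion₂.mp hγ
      rcases hj.1.eq_or_lt with rfl | hlt
      · exact Ideal.mem_sup_left (Ideal.subset_span (Set.mem_image_of_mem X hγj))
      · exact Ideal.mem_sup_right (hmemA hlt hj.2 hγj)
    have key (k : ℕ) (hk : 1 ≤ k) : k ≤ r →
        (A 1 ⊓ ⨅ i ∈ Finset.Icc 2 k, (A i ⊔ Ideal.span (B i))) ≤ A k ⊔ J k := by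
      induction k, hk using Nat.le_induction with
      | base => exact fun _ => inf_le_left.trans le_sup_left
      | succ k hk ih =>
        intro hkr g hg
        have hg' : g ∈ A (k + 1) ⊔ Ideal.span (B (k + 1)) :=
          (inf_le_right.trans (iInf₂_le (k + 1) (Finset.mem_Icc.mpr ⟨by lia, le_rfl⟩)) :
            _ ≤ A (k + 1) ⊔ Ideal.span (B (k + 1))) hg
        have hgk : g ∈ A k ⊔ J k := ih (by lia)
          (inf_le_inf_left (A 1) (biInf_mono fun i hi =>
            Finset.Icc_subset_Icc_right k.le_succ hi) hg)
        obtain ⟨a, ha, c, hc, rfl⟩ := Submodule.mem_sup.mp hgk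
        obtain ⟨x, hx, b, hb, rfl⟩ := Submodule.mem_sup.mp (hAsucc ha)
        have hx' : x ∈ A (k + 1) ⊔ Ideal.span (B (k + 1)) := by
          have h := sub_mem hg' (Submodule.add_mem_sup hb (hJB hkr hc))
          rwa [add_assoc, add_sub_cancel_right] at h
        have hxJ : x ∈ A (k + 1) ⊔ J (k + 1) := by
          rw [hA (k + 1)] at hx' ⊢
          refine sup_le_sup_left (hmulJ (by lia)) _ (span_X_inf_sup_span_le
            (hBvars (by lia) hkr (by lia) hkr) (fun f hf i hi => ?_) ⟨hx, hx'⟩)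
          obtain ⟨j, hj, hij⟩ := Set.mem_iUnion₂.mp hi
          exact hBvars (by lia) hkr (by have := hj.1; lia) hj.2 f hf i hij
        exact add_mem (add_mem hxJ (Ideal.mem_sup_left hb)) (Ideal.mem_sup_right (hJmono k hc))
    have hAr : A r = ⊥ := by simp [hA]
    exact (key r (by lia) le_rfl).trans_eq (by rw [hAr, bot_sup_eq])
  · rw [Ideal.span_le]
    refine Set.iUnion₂_subset fun i hi => ?_
    rintro _ ⟨γ, hγ, f, hf, rfl⟩
    refine ⟨Ideal.mul_mem_right _ _ (hmemA hi.1 hi.2 hγ), ?_⟩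
    simp only [SetLike.mem_coe, Submodule.mem_iInf, Finset.mem_Icc]
    rintro j ⟨hj2, hjr⟩
    rcases lt_or_ge j i with hji | hij
    · exact Ideal.mem_sup_left (Ideal.mul_mem_right _ _ (hmemA hji hi.2 hγ))
    · exact Ideal.mem_sup_right
        (Ideal.mul_mem_left _ _ (Ideal.subset_span (hB i j hi.1 hij hjr hf)))
end

section
/- For integers c, p ≥ 1, the polynomials h(c,p) ∈ ℤ[t] satisfy the identity 1 − t^c · h(c,p)(1 − t) = (1 − t)^p · h(p,c)(t), where h(c,p)(1 − t) denotes the composition of h(c,p) with the polynomial 1 − t. -/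
open Polynomial

/-- The polynomial `h(c,p)(t) = ∑_{i=0}^{p-1} C(c+i-1, i) t^i` in `ℤ[t]`. -/
noncomputable def hPoly (c p : ℕ) : Polynomial ℤ :=
  ∑ i ∈ Finset.range p, (((c + i - 1).choose i : ℤ)) • (X : Polynomial ℤ) ^ i

lemma hPoly_succ_right (c p : ℕ) :
    hPoly c (p + 1) = hPoly c p + (((c + p - 1).choose p : ℤ)) • (X : Polynomial ℤ) ^ p :=
  Finset.sum_range_succ _ _

lemma hPoly_one_right (c : ℕ) : hPoly c 1 = 1 := by
  simp [hPoly]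

lemma hPoly_eq_one_sub_X_mul_hPoly_succ_left (p m : ℕ) :
    hPoly p (m + 1) =
      (1 - X) * hPoly (p + 1) (m + 1) + ((p + m).choose m : ℤ) • X ^ (m + 1) := by
  induction m with
  | zero => simp [hPoly_one_right]
  | succ m ih =>
    have h₁ : p + (m + 1) - 1 = p + m := by omega
    have h₂ : p + 1 + (m + 1) - 1 = p + m + 1 := by omega
    rw [hPoly_succ_right p, hPoly_succ_right (p + 1), ih, h₁, h₂, ← add_assoc p m 1,
      Nat.choose_succ_succ]
    simp only [zsmul_eq_mul]
    push_cast
    ring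

lemma hPoly_zero_left_succ (m : ℕ) : hPoly 0 (m + 1) = 1 := by
  simp [hPoly, Finset.sum_range_succ']

/-- For `c, p ≥ 1` one has `1 - t^c ⬝ h(c,p)(1-t) = (1-t)^p ⬝ h(p,c)(t)`. -/
theorem hPoly_duality (c p : ℕ) (hc : 1 ≤ c) (hp : 1 ≤ p) :
    1 - X ^ c * (hPoly c p).comp (1 - X) = (1 - X) ^ p * hPoly p c := by
  obtain ⟨m, rfl⟩ := Nat.exists_eq_add_of_le' hc
  clear hc hp
  induction p with
  | zero => simp [hPoly_zero_left_succ, hPoly.eq_1 _ 0]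
  | succ p ih =>
    have h : (m + 1 + p - 1).choose p = (p + m).choose m := by
      rw [show m + 1 + p - 1 = p + m by omega, Nat.choose_symm_add]
    rw [hPoly_eq_one_sub_X_mul_hPoly_succ_left] at ih
    rw [hPoly_succ_right, h]
    simp only [zsmul_eq_mul, add_comp, mul_comp, intCast_comp, pow_comp, X_comp] at ih ⊢
    linear_combination ih
end
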